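/- Let F : C ⥤ X be a faithful functor. Suppose A and A′ are objects of C with h : F.obj A′ = F.obj A, and suppose (f_i : A ⟶ A_i)_{i ∈ I} and (f_i′ : A′ ⟶ A_i)_{i ∈ I} are both initial sources such that for each i ∈ I, F.map f_i′ = eqToHom h ≫ F.map f_i (i.e. they lie over the same underlying family of X-morphisms). Then there exists an isomorphism ψ : A′ ≅ A in C with F.map ψ.hom = eqToHom h; in particular A and A′ define the same structure. (Uniqueness of the initial structure with respect to a given family of underlying morphisms.) -/

import Mathlib

open CategoryTheory

/-- A source `(f i : A ⟶ A_ i)` in a concrete category `(C, F, X)` is initial if for every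
object `B` of `C` and every `X`-morphism `g : F.obj B ⟶ F.obj A`, `g` lifts to a `C`-morphism
`B ⟶ A` iff each composite `g ≫ F.map (f i)` lifts to a `C`-morphism `B ⟶ A_ i`. -/
def IsInitialSource {C X : Type*} [Category C] [Category X] (F : C ⥤ X)
    {I : Type*} {A : C} {As : I → C} (f : ∀ i, A ⟶ As i) : Prop :=
  ∀ (B : C) (g : F.obj B ⟶ F.obj A),
    (∃ gbar : B ⟶ A, F.map gbar = g) ↔ ∀ i, ∃ hᵢ : B ⟶ As i, F.map hᵢ = g ≫ F.map (f i)

theorem initial_structure_unique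
    {C X : Type*} [Category C] [Category X] (F : C ⥤ X) (hF : F.Faithful)
    {I : Type*} {A A' : C} {As : I → C}
    (f : ∀ i, A ⟶ As i) (f' : ∀ i, A' ⟶ As i)
    (h : F.obj A' = F.obj A)
    (hinit : IsInitialSource F f) (hinit' : IsInitialSource F f')
    (hsame : ∀ i, F.map (f' i) = eqToHom h ≫ F.map (f i)) :
    ∃ ψ : A' ≅ A, F.map ψ.hom = eqToHom h := by
  obtain ⟨u, hu⟩ := (hinit A' (eqToHom h)).2 fun i => ⟨f' i, hsame i⟩
  obtain ⟨v, hv⟩ := (hinit' A (eqToHom h.symm)).2 fun i => ⟨f i, by simp [hsame]⟩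
  exact ⟨⟨u, v, F.map_injective (by simp [hu, hv]), F.map_injective (by simp [hu, hv])⟩, hu⟩
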